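/- arXiv:1503.08329 — 4 statements merged into one kernel-verified Lean document; each statement's English description precedes it below -/
import Mathlib

section
/- (The C-bound.) For any probability distribution Q on a set H of voters f : X → [-1,1] and any probability distribution D' on X × {-1,1}, if μ1 > 0 (equivalently R_{D'}(G_Q) < 1/2), then R_{D'}(B_Q) ≤ C_Q^{D'}, where C_Q^{D'} := (μ2 − μ1²)/μ2 = 1 − μ1²/μ2 = 1 − (1 − 2·R_{D'}(G_Q))²/(1 − 2·d_Q^{D'}). -/
open MeasureTheory

/-- The margin of the `Q`-weighted majority vote on an example `p = (x, y)`: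
`M_Q(x,y) = y * E_{f ∼ Q} f(x)`. -/
noncomputable def margin {X ι : Type*} [MeasurableSpace ι] (F : ι → X → ℝ)
    (Q : Measure ι) (p : X × ℝ) : ℝ :=
  p.2 * ∫ i, F i p.1 ∂Q

/-- First moment of the margin under `D'`. -/
noncomputable def mu1 {X ι : Type*} [MeasurableSpace X] [MeasurableSpace ι]
    (F : ι → X → ℝ) (Q : Measure ι) (D' : Measure (X × ℝ)) : ℝ :=
  ∫ p, margin F Q p ∂D'

/-- Second moment of the margin under `D'`. -/
noncomputable def mu2 {X ι : Type*} [MeasurableSpace X] [MeasurableSpace ι]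
    (F : ι → X → ℝ) (Q : Measure ι) (D' : Measure (X × ℝ)) : ℝ :=
  ∫ p, (margin F Q p) ^ 2 ∂D'

/-- Bayes risk (risk of the majority vote): `Pr_{(x,y) ∼ D'}(M_Q(x,y) ≤ 0)`. -/
noncomputable def bayesRisk {X ι : Type*} [MeasurableSpace X] [MeasurableSpace ι]
    (F : ι → X → ℝ) (Q : Measure ι) (D' : Measure (X × ℝ)) : ℝ :=
  (D' {p | margin F Q p ≤ 0}).toReal

/-- Gibbs risk: `R_{D'}(G_Q) = (1 - μ₁(M_Q^{D'})) / 2`. -/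
noncomputable def gibbsRisk {X ι : Type*} [MeasurableSpace X] [MeasurableSpace ι]
    (F : ι → X → ℝ) (Q : Measure ι) (D' : Measure (X × ℝ)) : ℝ :=
  (1 - mu1 F Q D') / 2

/-- Expected disagreement: `d_Q^{D'} = (1 - μ₂(M_Q^{D'})) / 2`. -/
noncomputable def disagreement {X ι : Type*} [MeasurableSpace X] [MeasurableSpace ι]
    (F : ι → X → ℝ) (Q : Measure ι) (D' : Measure (X × ℝ)) : ℝ :=
  (1 - mu2 F Q D') / 2

/-- Second-moment inequality: for every `t`, the tail `{g ≤ 0}` is controlled by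
`E (1 - t g)² = 1 - 2 t E g + t² E g²`, because `1 - t g ≥ 1` on that set. -/
lemma measureReal_nonpos_le {Ω : Type*} [MeasurableSpace Ω] {P : Measure Ω}
    [IsProbabilityMeasure P] {g : Ω → ℝ} (hg : MemLp g 2 P) {t : ℝ} (ht : 0 ≤ t) :
    P.real {ω | g ω ≤ 0} ≤ 1 - 2 * t * ∫ ω, g ω ∂P + t ^ 2 * ∫ ω, g ω ^ 2 ∂P := by
  have hg1 : Integrable g P := hg.integrable one_le_two
  have hg2 : Integrable (fun ω => g ω ^ 2) P := hg.integrable_sq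
  have hlin : Integrable (fun ω => 1 - 2 * t * g ω) P :=
    (integrable_const 1).sub (hg1.const_mul (2 * t))
  have hint : Integrable (fun ω => 1 - 2 * t * g ω + t ^ 2 * g ω ^ 2) P :=
    hlin.add (hg2.const_mul (t ^ 2))
  have hsq (ω : Ω) : 1 - 2 * t * g ω + t ^ 2 * g ω ^ 2 = (1 - t * g ω) ^ 2 := by ring
  have hmarkov := mul_meas_ge_le_integral_of_nonneg
    (Filter.Eventually.of_forall fun ω => (hsq ω).symm ▸ sq_nonneg (1 - t * g ω)) hint 1
  rw [integral_add hlin (hg2.const_mul _), integral_sub (integrable_const 1) (hg1.const_mul _),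
    integral_const_mul, integral_const_mul, integral_const, probReal_univ, one_smul,
    one_mul] at hmarkov
  refine le_trans (measureReal_mono fun ω hω => ?_) hmarkov
  have hω : g ω ≤ 0 := hω
  have : 0 ≤ t * -g ω := mul_nonneg ht (neg_nonneg.mpr hω)
  change 1 ≤ 1 - 2 * t * g ω + t ^ 2 * g ω ^ 2
  nlinarith [sq_nonneg (t * g ω)]

/-- A square-integrable random variable with positive mean has positive second moment. -/
lemma integral_sq_pos_of_integral_pos {Ω : Type*} [MeasurableSpace Ω] {P : Measure Ω}
    [IsProbabilityMeasure P] {g : Ω → ℝ} (hg : MemLp g 2 P) (hpos : 0 < ∫ ω, g ω ∂P) :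
    0 < ∫ ω, g ω ^ 2 ∂P := by
  refine (integral_nonneg fun ω => sq_nonneg (g ω)).lt_of_ne fun h => ?_
  have hle := measureReal_nonneg.trans (measureReal_nonpos_le hg (inv_nonneg.mpr hpos.le))
  rw [← h, mul_assoc, inv_mul_cancel₀ hpos.ne'] at hle
  norm_num at hle

/-- One-sided Chebyshev inequality at `0`, for a random variable with positive mean. -/
lemma measureReal_nonpos_le_one_sub {Ω : Type*} [MeasurableSpace Ω] {P : Measure Ω}
    [IsProbabilityMeasure P] {g : Ω → ℝ} (hg : MemLp g 2 P) (hpos : 0 < ∫ ω, g ω ∂P) :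
    P.real {ω | g ω ≤ 0} ≤ 1 - (∫ ω, g ω ∂P) ^ 2 / ∫ ω, g ω ^ 2 ∂P := by
  have h2 := integral_sq_pos_of_integral_pos hg hpos
  refine (measureReal_nonpos_le hg (div_nonneg hpos.le h2.le)).trans_eq ?_
  field_simp
  ring

/-- The margin of a majority vote of `[-1,1]`-valued voters is square-integrable. -/
lemma memLp_margin {X ι : Type*} [MeasurableSpace X] [MeasurableSpace ι]
    {F : ι → X → ℝ} (hF : ∀ i x, F i x ∈ Set.Icc (-1 : ℝ) 1)
    {Q : Measure ι} [IsProbabilityMeasure Q]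
    {D' : Measure (X × ℝ)} [IsProbabilityMeasure D']
    (hY : ∀ᵐ p ∂D', p.2 = 1 ∨ p.2 = -1)
    (hmeas : Measurable fun x : X => ∫ i, F i x ∂Q) :
    MemLp (margin F Q) 2 D' := by
  have hm : Measurable (margin F Q) := measurable_snd.mul (hmeas.comp measurable_fst)
  refine MemLp.of_bound hm.aestronglyMeasurable 1 ?_
  filter_upwards [hY] with p hp
  have hvote : ‖∫ i, F i p.1 ∂Q‖ ≤ 1 := by
    simpa using norm_integral_le_of_norm_le_const (μ := Q) (f := fun i => F i p.1) (C := 1)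
      (Filter.Eventually.of_forall fun i => abs_le.mpr (hF i p.1))
  rcases hp with hp | hp <;> simpa [margin, hp] using hvote

/-- The C-bound: if `μ₁ > 0` (i.e. `R_{D'}(G_Q) < 1/2`) then
`R_{D'}(B_Q) ≤ C_Q^{D'}`, where `C_Q^{D'}` is given in its three equivalent forms:
`Var/μ₂ = (μ₂ - μ₁²)/μ₂ = 1 - μ₁²/μ₂ = 1 - (1 - 2 R_{D'}(G_Q))²/(1 - 2 d_Q^{D'})`. -/
theorem statement1
    {X ι : Type*} [MeasurableSpace X] [MeasurableSpace ι]
    (F : ι → X → ℝ) (hF : ∀ i x, F i x ∈ Set.Icc (-1 : ℝ) 1)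
    (Q : Measure ι) [IsProbabilityMeasure Q]
    (D' : Measure (X × ℝ)) [IsProbabilityMeasure D']
    (hY : ∀ᵐ p ∂D', p.2 = 1 ∨ p.2 = -1)
    (hmeas : Measurable fun x : X => ∫ i, F i x ∂Q)
    (hmu1 : 0 < mu1 F Q D') :
    bayesRisk F Q D' ≤ (mu2 F Q D' - (mu1 F Q D') ^ 2) / mu2 F Q D' ∧
    (mu2 F Q D' - (mu1 F Q D') ^ 2) / mu2 F Q D'
      = 1 - (mu1 F Q D') ^ 2 / mu2 F Q D' ∧
    (mu2 F Q D' - (mu1 F Q D') ^ 2) / mu2 F Q D'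
      = 1 - (1 - 2 * gibbsRisk F Q D') ^ 2 / (1 - 2 * disagreement F Q D') := by
  have hg := memLp_margin hF hY hmeas
  have h2 : 0 < mu2 F Q D' := integral_sq_pos_of_integral_pos hg hmu1
  have hform : (mu2 F Q D' - mu1 F Q D' ^ 2) / mu2 F Q D'
      = 1 - mu1 F Q D' ^ 2 / mu2 F Q D' := by
    rw [sub_div, div_self h2.ne']
  refine ⟨hform ▸ measureReal_nonpos_le_one_sub hg hmu1, hform, ?_⟩
  rw [hform, gibbsRisk, disagreement]
  ring
end

section
/- Let f_1,…,f_n : X → [-1,1] be voters such that Cov_{(x,y)∼D'}(y·f_i(x), y·f_j(x)) = 0 for all i ≠ j, and let Q be the uniform distribution on {f_1,…,f_n}. If R_{D'}(G_Q) < 1/2, then R_{D'}(B_Q) ≤ C_Q^{D'} ≤ 1/(n·(1 − 2·d_Q^{D'})) ≤ 1/(n·(1 − 2·R_{D'}(G_Q))²), where C_Q^{D'} := 1 − (1 − 2·R_{D'}(G_Q))²/(1 − 2·d_Q^{D'}). -/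
open MeasureTheory

/-- Margin of the uniform majority vote over `n` voters on `p = (x, y)`:
`M_Q(x,y) = y · (1/n) Σ_i f_i(x)`. -/
noncomputable def umargin {X : Type*} {n : ℕ} (F : Fin n → X → ℝ) (p : X × ℝ) : ℝ :=
  p.2 * ((n : ℝ)⁻¹ * ∑ i, F i p.1)

/-- First moment of the margin of the uniform majority vote. -/
noncomputable def umu1 {X : Type*} [MeasurableSpace X] {n : ℕ} (F : Fin n → X → ℝ)
    (D' : Measure (X × ℝ)) : ℝ :=
  ∫ p, umargin F p ∂D'

/-- Second moment of the margin of the uniform majority vote. -/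
noncomputable def umu2 {X : Type*} [MeasurableSpace X] {n : ℕ} (F : Fin n → X → ℝ)
    (D' : Measure (X × ℝ)) : ℝ :=
  ∫ p, (umargin F p) ^ 2 ∂D'

/-- Gibbs risk of the uniform majority vote. -/
noncomputable def ugibbs {X : Type*} [MeasurableSpace X] {n : ℕ} (F : Fin n → X → ℝ)
    (D' : Measure (X × ℝ)) : ℝ :=
  (1 - umu1 F D') / 2

/-- Expected disagreement of the uniform majority vote. -/
noncomputable def udisag {X : Type*} [MeasurableSpace X] {n : ℕ} (F : Fin n → X → ℝ)
    (D' : Measure (X × ℝ)) : ℝ :=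
  (1 - umu2 F D') / 2

/-- Bayes risk of the uniform majority vote. -/
noncomputable def ubayes {X : Type*} [MeasurableSpace X] {n : ℕ} (F : Fin n → X → ℝ)
    (D' : Measure (X × ℝ)) : ℝ :=
  (D' {p | umargin F p ≤ 0}).toReal

/-- A one-sided Chebyshev–Cantelli bound, phrased with the first two moments. -/
theorem measureReal_nonpos_le_one_sub_s6 {Ω : Type*} [MeasurableSpace Ω] {μ : Measure Ω}
    [IsProbabilityMeasure μ] {M : Ω → ℝ} (hM : MemLp M 2 μ) (hmeas : Measurable M)
    (h1 : 0 ≤ ∫ ω, M ω ∂μ) (h2 : 0 < ∫ ω, M ω ^ 2 ∂μ) :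
    μ.real {ω | M ω ≤ 0} ≤ 1 - (∫ ω, M ω ∂μ) ^ 2 / ∫ ω, M ω ^ 2 ∂μ := by
  set a := ∫ ω, M ω ∂μ with ha
  set b := ∫ ω, M ω ^ 2 ∂μ with hb
  have hs : MeasurableSet {ω | M ω ≤ 0} := measurableSet_le hmeas measurable_const
  have hi1 : Integrable M μ := hM.integrable one_le_two
  have hi2 : Integrable (fun ω => M ω ^ 2) μ := hM.integrable_sq
  have ht : 0 ≤ a / b := by positivity
  have hlin : Integrable (fun ω => 1 - 2 * (a / b) * M ω) μ :=
    (integrable_const 1).sub (hi1.const_mul _)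
  have hquad : Integrable (fun ω => (a / b) ^ 2 * M ω ^ 2) μ := hi2.const_mul _
  have hint : ∫ ω, ((1 - 2 * (a / b) * M ω) + (a / b) ^ 2 * M ω ^ 2) ∂μ
      = 1 - 2 * (a / b) * a + (a / b) ^ 2 * b := by
    rw [integral_add hlin hquad, integral_sub (integrable_const 1) (hi1.const_mul _),
      integral_const_mul, integral_const_mul]
    simp [ha, hb]
  calc μ.real {ω | M ω ≤ 0} = ∫ ω, {ω | M ω ≤ 0}.indicator 1 ω ∂μ :=
        (integral_indicator_one hs).symm
    _ ≤ ∫ ω, ((1 - 2 * (a / b) * M ω) + (a / b) ^ 2 * M ω ^ 2) ∂μ := by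
        refine integral_mono ((integrable_const (1 : ℝ)).indicator hs) (hlin.add hquad) fun ω => ?_
        by_cases hω : M ω ≤ 0
        · have : {ω | M ω ≤ 0}.indicator (1 : Ω → ℝ) ω = 1 := by simp [hω]
          simp only [this]
          nlinarith [mul_nonneg ht (neg_nonneg.2 hω), sq_nonneg (a / b * M ω)]
        · have : {ω | M ω ≤ 0}.indicator (1 : Ω → ℝ) ω = 0 := by simp [hω]
          simp only [this]
          nlinarith [sq_nonneg (1 - a / b * M ω)]
    _ = 1 - a ^ 2 / b := by
        rw [hint]
        field_simp
        ring

open ProbabilityTheory in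
/-- The average of `n` pairwise uncorrelated variables with values in `[-1, 1]` has variance at
most `1 / n`. -/
theorem variance_average_le_inv {Ω : Type*} [MeasurableSpace Ω] {μ : Measure Ω}
    [IsProbabilityMeasure μ] {n : ℕ} {g : Fin n → Ω → ℝ} (hg : ∀ i, AEMeasurable (g i) μ)
    (hbound : ∀ i, ∀ᵐ ω ∂μ, g i ω ∈ Set.Icc (-1 : ℝ) 1)
    (hcov : ∀ i j, i ≠ j → cov[g i, g j; μ] = 0) :
    Var[fun ω => (n : ℝ)⁻¹ * ∑ i, g i ω; μ] ≤ (n : ℝ)⁻¹ := by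
  have hL (i) : MemLp (g i) 2 μ := memLp_of_bounded (hbound i) (hg i).aestronglyMeasurable 2
  have hvar (i) : Var[g i; μ] ≤ 1 := by
    have := variance_le_sq_of_bounded (hbound i) (hg i)
    norm_num at this
    exact this
  have hsum : Var[fun ω => ∑ i, g i ω; μ] = ∑ i, Var[g i; μ] := by
    rw [variance_fun_sum hL]
    refine Finset.sum_congr rfl fun i _ => ?_
    rw [Finset.sum_eq_single i (fun j _ hj => hcov i j hj.symm) (by simp), covariance_self (hg i)]
  rw [variance_const_mul, hsum]
  have hle : ∑ i, Var[g i; μ] ≤ n := by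
    simpa using Finset.sum_le_sum fun i (_ : i ∈ Finset.univ) => hvar i
  calc ((n : ℝ)⁻¹) ^ 2 * ∑ i, Var[g i; μ] ≤ ((n : ℝ)⁻¹) ^ 2 * n := by gcongr
    _ = (n : ℝ)⁻¹ := by
        rcases eq_or_ne (n : ℝ) 0 with h | h
        · simp [h]
        · field_simp

/-- With `n` pairwise uncorrelated voters under the uniform distribution and
`R_{D'}(G_Q) < 1/2`:
`R_{D'}(B_Q) ≤ C_Q^{D'} ≤ 1/(n·(1 - 2 d_Q^{D'})) ≤ 1/(n·(1 - 2 R_{D'}(G_Q))²)`. -/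
theorem statement6 {X : Type*} [MeasurableSpace X] (n : ℕ) (hn : 0 < n)
    (F : Fin n → X → ℝ) (hF : ∀ i x, F i x ∈ Set.Icc (-1 : ℝ) 1)
    (hFmeas : ∀ i, Measurable (F i))
    (D' : Measure (X × ℝ)) [IsProbabilityMeasure D']
    (hY : ∀ᵐ p ∂D', p.2 = 1 ∨ p.2 = -1)
    (hcov : ∀ i j, i ≠ j →
      (∫ p, (p.2 * F i p.1) * (p.2 * F j p.1) ∂D')
        - (∫ p, p.2 * F i p.1 ∂D') * (∫ p, p.2 * F j p.1 ∂D') = 0)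
    (hgibbs : ugibbs F D' < 1 / 2) :
    ubayes F D' ≤ 1 - (1 - 2 * ugibbs F D') ^ 2 / (1 - 2 * udisag F D') ∧
    1 - (1 - 2 * ugibbs F D') ^ 2 / (1 - 2 * udisag F D')
      ≤ 1 / ((n : ℝ) * (1 - 2 * udisag F D')) ∧
    1 / ((n : ℝ) * (1 - 2 * udisag F D'))
      ≤ 1 / ((n : ℝ) * (1 - 2 * ugibbs F D') ^ 2) := by
  have hmeas (i) : Measurable fun p : X × ℝ => p.2 * F i p.1 :=
    measurable_snd.mul ((hFmeas i).comp measurable_fst)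
  have hbound (i) : ∀ᵐ p ∂D', p.2 * F i p.1 ∈ Set.Icc (-1 : ℝ) 1 := by
    filter_upwards [hY] with p hp
    have := hF i p.1
    rw [Set.mem_Icc] at this ⊢
    rcases hp with hp | hp <;> rw [hp] <;> constructor <;> linarith
  have hL (i) : MemLp (fun p : X × ℝ => p.2 * F i p.1) 2 D' :=
    memLp_of_bounded (hbound i) (hmeas i).aestronglyMeasurable 2
  have hmargin : umargin F = fun p => (n : ℝ)⁻¹ * ∑ i, p.2 * F i p.1 := by
    funext p
    rw [umargin, ← Finset.mul_sum]
    ring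
  have hMmeas : Measurable (umargin F) := by
    rw [hmargin]
    exact (Finset.measurable_fun_sum _ fun i _ => hmeas i).const_mul _
  have hML : MemLp (umargin F) 2 D' := by
    rw [hmargin]
    exact (memLp_finsetSum _ fun i _ => hL i).const_mul _
  have hvar : umu2 F D' - umu1 F D' ^ 2 ≤ (n : ℝ)⁻¹ := by
    have h := variance_average_le_inv (fun i => (hmeas i).aemeasurable) hbound fun i j hij => by
      rw [ProbabilityTheory.covariance_eq_sub (hL i) (hL j)]
      exact hcov i j hij
    rwa [← hmargin, ProbabilityTheory.variance_eq_sub hML] at h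
  have hsq : umu1 F D' ^ 2 ≤ umu2 F D' := by
    have h := ProbabilityTheory.variance_nonneg (umargin F) D'
    rw [ProbabilityTheory.variance_eq_sub hML] at h
    exact sub_nonneg.1 h
  have hg : 1 - 2 * ugibbs F D' = umu1 F D' := by rw [ugibbs]; ring
  have hd : 1 - 2 * udisag F D' = umu2 F D' := by rw [udisag]; ring
  have h1 : 0 < umu1 F D' := by linarith
  have h2 : 0 < umu2 F D' := (pow_pos h1 2).trans_le hsq
  have hn' : (0 : ℝ) < n := by exact_mod_cast hn
  rw [hg, hd]
  refine ⟨measureReal_nonpos_le_one_sub_s6 hML hMmeas h1.le h2, ?_, by gcongr⟩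
  calc 1 - umu1 F D' ^ 2 / umu2 F D' = (umu2 F D' - umu1 F D' ^ 2) / umu2 F D' := by
        rw [sub_div, div_self h2.ne']
    _ ≤ (n : ℝ)⁻¹ / umu2 F D' := by gcongr
    _ = 1 / (n * umu2 F D') := by field_simp
end

section
/- (General PAC-Bayesian theorem for real-valued losses.) For any distribution D on X × Y, any set H of voters, any loss L : [-1,1] × Y → [0,1], any prior distribution P on H, any δ ∈ (0,1], any m' > 0, and any convex function 𝒟 : [0,1] × [0,1] → ℝ: with probability at least 1 − δ over the draw of S ∼ D^m, simultaneously for all posterior distributions Q on H, 𝒟(E_{f∼Q} E_{L,S}(f), E_{f∼Q} E_{L,D}(f)) ≤ (1/m')·[KL(Q‖P) + ln((1/δ)·E_{S'∼D^m} E_{f∼P} e^{m'·𝒟(E_{L,S'}(f), E_{L,D}(f))})]. -/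
open MeasureTheory

open Classical in
/-- Kullback–Leibler divergence `KL(Q‖P) = E_{f∼Q} ln (dQ/dP)(f)`, with value `⊤`
when `Q` is not absolutely continuous w.r.t. `P` or the divergence is not finite. -/
noncomputable def klDivE {ι : Type*} [MeasurableSpace ι] (Q P : Measure ι) : EReal :=
  if Q ≪ P ∧ Integrable (fun i => Real.log ((Q.rnDeriv P) i).toReal) Q
  then ((∫ i, Real.log ((Q.rnDeriv P) i).toReal ∂Q : ℝ) : EReal)
  else ⊤

/-- Empirical expected loss of voter `i` on the sample `S`:
`E_{L,S}(f) = (1/m) Σ_k L(f(x_k), y_k)`. -/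
noncomputable def empLoss {X ι : Type*} (L : ℝ → ℝ → ℝ) (F : ι → X → ℝ) {m : ℕ}
    (S : Fin m → X × ℝ) (i : ι) : ℝ :=
  (m : ℝ)⁻¹ * ∑ k, L (F i (S k).1) (S k).2

/-- True expected loss of voter `i` under `D`: `E_{L,D}(f) = E_{(x,y)∼D} L(f(x), y)`. -/
noncomputable def trueLoss {X ι : Type*} [MeasurableSpace X] (L : ℝ → ℝ → ℝ)
    (F : ι → X → ℝ) (D : Measure (X × ℝ)) (i : ι) : ℝ :=
  ∫ p, L (F i p.1) p.2 ∂D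

theorem Convex.zero_mem_of_integral_eq_zero {Ω : Type*} [MeasurableSpace Ω] {μ : Measure Ω}
    [IsProbabilityMeasure μ] (n : ℕ) : ∀ (E : Type*) [NormedAddCommGroup E] [NormedSpace ℝ E]
    [FiniteDimensional ℝ E], Module.finrank ℝ E = n → ∀ (s : Set E), Convex ℝ s →
    ∀ g : Ω → E, Integrable g μ → (∀ᵐ ω ∂μ, g ω ∈ s) → ∫ ω, g ω ∂μ = 0 → (0 : E) ∈ s := by
  induction n using Nat.strong_induction_on with
  | _ n ih =>
    intro E _ _ _ hE s hs g hg hgs hg0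
    by_contra h0
    obtain ⟨φ, hφ, hφs⟩ : ∃ φ : StrongDual ℝ E, φ ≠ 0 ∧ ∀ x ∈ s, φ x ≤ 0 := by
      by_cases hint : (interior s).Nonempty
      · simpa using geometric_hahn_banach_of_nonempty_interior_point hs
          (fun h => h0 (interior_subset h)) hint
      · have hspan : affineSpan ℝ s ≠ ⊤ := fun h =>
          hint (hs.interior_nonempty_iff_affineSpan_eq_top.2 h)
        have hmem : (0 : E) ∈ affineSpan ℝ s := by
          rw [← hg0]
          exact (affineSpan ℝ s).convex.integral_mem
            (AffineSubspace.closed_of_finiteDimensional _)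
            (hgs.mono fun ω h => subset_affineSpan ℝ s h) hg
        have hdir : (affineSpan ℝ s).direction < ⊤ := by
          rw [lt_top_iff_ne_top]
          exact fun h => hspan ((AffineSubspace.direction_eq_top_iff_of_nonempty ⟨0, hmem⟩).1 h)
        obtain ⟨f, hf, hfker⟩ := Submodule.exists_le_ker_of_lt_top _ hdir
        refine ⟨f.toContinuousLinearMap, by simpa using hf, fun x hx => ?_⟩
        have := hfker (AffineSubspace.vsub_mem_direction (subset_affineSpan ℝ s hx) hmem)
        simpa using this.le
    have hker : ∀ᵐ ω ∂μ, φ (g ω) = 0 := by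
      have h1 : ∫ ω, -φ (g ω) ∂μ = 0 := by
        rw [integral_neg, φ.integral_comp_comm hg, hg0]; simp
      have h2 := (integral_eq_zero_iff_of_nonneg_ae (f := fun ω => -φ (g ω))
        (hgs.mono fun ω h => by simpa using hφs _ h) (φ.integrable_comp hg).neg).1 h1
      exact h2.mono fun ω h => by simpa using h
    set K := LinearMap.ker (φ : E →ₗ[ℝ] ℝ) with hK
    obtain ⟨π, hπ⟩ := K.subtype.exists_leftInverse_of_injective (by simp)
    have hπ' : ∀ x (hx : x ∈ K), π x = ⟨x, hx⟩ := fun x hx => LinearMap.congr_fun hπ ⟨x, hx⟩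
    have hlt : Module.finrank ℝ K < n := by
      rw [← hE]
      refine Submodule.finrank_lt fun h => hφ ?_
      ext x
      have : x ∈ K := h ▸ Submodule.mem_top
      simpa [hK] using this
    have := ih _ hlt K rfl (K.subtype ⁻¹' s) (hs.linear_preimage K.subtype)
      (fun ω => π.toContinuousLinearMap (g ω)) (π.toContinuousLinearMap.integrable_comp hg)
      (by
        filter_upwards [hgs, hker] with ω h1 h2
        simpa [hπ' _ (show g ω ∈ K from h2)] using h1)
      (by rw [ContinuousLinearMap.integral_comp_comm _ hg, hg0, map_zero])
    exact h0 (by simpa using this)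

/-- The mean of a random vector with values in a finite-dimensional convex set, not necessarily
closed, belongs to this set. -/
theorem Convex.integral_mem_of_finiteDimensional {Ω E : Type*} [MeasurableSpace Ω]
    {μ : Measure Ω} [IsProbabilityMeasure μ] [NormedAddCommGroup E] [NormedSpace ℝ E]
    [FiniteDimensional ℝ E] {s : Set E} (hs : Convex ℝ s) {g : Ω → E} (hg : Integrable g μ)
    (hgs : ∀ᵐ ω ∂μ, g ω ∈ s) : ∫ ω, g ω ∂μ ∈ s := by
  have := Convex.zero_mem_of_integral_eq_zero (μ := μ) _ E rfl
    ((fun x => x + ∫ ω, g ω ∂μ) ⁻¹' s) (hs.translate_preimage_left _)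
    (fun ω => g ω - ∫ ω, g ω ∂μ) (hg.sub (integrable_const _)) (by simpa using hgs)
    (by rw [integral_sub hg (integrable_const _)]; simp)
  simpa using this

/-- Jensen's inequality on a finite-dimensional convex set, without any continuity assumption. -/
theorem ConvexOn.map_integral_le_of_finiteDimensional {Ω E : Type*} [MeasurableSpace Ω]
    {μ : Measure Ω} [IsProbabilityMeasure μ] [NormedAddCommGroup E] [NormedSpace ℝ E]
    [FiniteDimensional ℝ E] {s : Set E} {f : E → ℝ} (hf : ConvexOn ℝ s f) {g : Ω → E}
    (hg : Integrable g μ) (hgs : ∀ᵐ ω ∂μ, g ω ∈ s) (hfg : Integrable (fun ω => f (g ω)) μ) :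
    f (∫ ω, g ω ∂μ) ≤ ∫ ω, f (g ω) ∂μ := by
  have := hf.convex_epigraph.integral_mem_of_finiteDimensional (hg.prodMk hfg)
    (hgs.mono fun ω h => ⟨h, le_rfl⟩)
  rw [integral_pair hg hfg] at this
  exact this.2

/-- The **Donsker–Varadhan** change of measure inequality. -/
theorem integral_le_integral_llr_add_log {Ω : Type*} [MeasurableSpace Ω] {μ ν : Measure Ω}
    [IsProbabilityMeasure μ] [IsProbabilityMeasure ν] (hμν : μ ≪ ν)
    (hllr : Integrable (llr μ ν) μ) {φ : Ω → ℝ} (hφ : Integrable φ μ)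
    (hexp : Integrable (fun x => Real.exp (φ x)) ν) :
    ∫ x, φ x ∂μ ≤ ∫ x, llr μ ν x ∂μ + Real.log (∫ x, Real.exp (φ x) ∂ν) := by
  have := isProbabilityMeasure_tilted hexp
  have h := InformationTheory.integral_llr_add_sub_measure_univ_nonneg
    (hμν.trans (absolutelyContinuous_tilted hexp))
    (integrable_llr_tilted_right hμν hφ hllr hexp)
  rw [integral_llr_tilted_right hμν hφ hexp hllr] at h
  simp only [probReal_univ] at h
  linarith

theorem measurable_indicator_union {α : Type*} [MeasurableSpace α] {s t : Set α} {f : α → ℝ}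
    (hs : MeasurableSet s) (hsf : Measurable (s.indicator f)) (htf : Measurable (t.indicator f)) :
    Measurable ((s ∪ t).indicator f) := by
  classical
  have : (s ∪ t).indicator f = s.piecewise (s.indicator f) (t.indicator f) := by
    ext x
    by_cases h : x ∈ s <;> by_cases h' : x ∈ t <;> simp [h, h']
  rw [this]
  exact hsf.piecewise hs htf

theorem ContinuousOn.measurable_indicator {α : Type*} [TopologicalSpace α] [MeasurableSpace α]
    [BorelSpace α] {s : Set α} {f : α → ℝ} (hf : ContinuousOn f s) (hs : MeasurableSet s) :
    Measurable (s.indicator f) := by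
  classical
  rw [← Set.piecewise_eq_indicator]
  exact hf.measurable_piecewise continuousOn_const hs

theorem measurable_indicator_singleton {α : Type*} [MeasurableSpace α] [MeasurableSingletonClass α]
    (a : α) (f : α → ℝ) : Measurable (({a} : Set α).indicator f) := by
  have : ({a} : Set α).indicator f = ({a} : Set α).indicator fun _ => f a := by
    ext x
    by_cases h : x = a <;> simp [h]
  rw [this]
  exact measurable_const.indicator (measurableSet_singleton a)

theorem ConvexOn.measurable_indicator_Icc {f : ℝ → ℝ} {a b : ℝ} (hab : a ≤ b)
    (hf : ConvexOn ℝ (Set.Icc a b) f) : Measurable ((Set.Icc a b).indicator f) := by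
  have h : Set.Icc a b = {a} ∪ ({b} ∪ Set.Ioo a b) := by
    ext x
    simp only [Set.mem_Icc, Set.mem_union, Set.mem_singleton_iff, Set.mem_Ioo]
    grind
  have hc := hf.continuousOn_interior
  rw [interior_Icc] at hc
  rw [h]
  exact measurable_indicator_union (measurableSet_singleton a) (measurable_indicator_singleton _ _)
    (measurable_indicator_union (measurableSet_singleton b) (measurable_indicator_singleton _ _)
      (hc.measurable_indicator measurableSet_Ioo))

theorem ConvexOn.measurable_indicator_vertical {f : ℝ × ℝ → ℝ} {s : Set ℝ} {c d : ℝ} (hcd : c ≤ d)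
    (hf : ConvexOn ℝ (s ×ˢ Set.Icc c d) f) {a : ℝ} (ha : a ∈ s) :
    Measurable ((({a} : Set ℝ) ×ˢ Set.Icc c d).indicator f) := by
  have h1 : ConvexOn ℝ (Set.Icc c d) fun y => f (a, y) := by
    refine ⟨convex_Icc c d, fun x hx y hy u v hu hv huv => ?_⟩
    have := hf.2 (x := (a, x)) ⟨ha, hx⟩ (y := (a, y)) ⟨ha, hy⟩ hu hv huv
    simpa [← add_mul, huv] using this
  have h2 : (({a} : Set ℝ) ×ˢ Set.Icc c d).indicator f = (Prod.fst ⁻¹' {a}).indicator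
      fun p => (Set.Icc c d).indicator (fun y => f (a, y)) p.2 := by
    ext ⟨x, y⟩
    by_cases hx : x = a <;> simp [Set.indicator, hx]
  rw [h2]
  exact ((h1.measurable_indicator_Icc hcd).comp measurable_snd).indicator
    (measurable_fst (measurableSet_singleton a))

theorem ConvexOn.measurable_indicator_rectangle {f : ℝ × ℝ → ℝ} {a b c d : ℝ} (hab : a ≤ b)
    (hcd : c ≤ d) (hf : ConvexOn ℝ (Set.Icc a b ×ˢ Set.Icc c d) f) :
    Measurable ((Set.Icc a b ×ˢ Set.Icc c d).indicator f) := by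
  have hswap : ConvexOn ℝ (Set.Icc c d ×ˢ Set.Icc a b) (f ∘ Prod.swap) := by
    have := hf.comp_linearMap (LinearEquiv.prodComm ℝ ℝ ℝ).toLinearMap
    convert! this using 1
    ext ⟨x, y⟩
    simp [and_comm]
  have horiz : ∀ y ∈ Set.Icc c d, Measurable ((Set.Icc a b ×ˢ ({y} : Set ℝ)).indicator f) := by
    intro y hy
    have h1 := (hswap.measurable_indicator_vertical hab hy).comp measurable_swap
    convert! h1 using 1
    ext ⟨u, v⟩
    simp [Set.indicator, and_comm]
  have hc := hf.continuousOn_interior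
  rw [interior_prod_eq, interior_Icc, interior_Icc] at hc
  have h : Set.Icc a b ×ˢ Set.Icc c d = {a} ×ˢ Set.Icc c d ∪ ({b} ×ˢ Set.Icc c d ∪
      (Set.Icc a b ×ˢ {c} ∪ (Set.Icc a b ×ˢ {d} ∪ Set.Ioo a b ×ˢ Set.Ioo c d))) := by
    ext ⟨x, y⟩
    simp only [Set.mem_prod, Set.mem_Icc, Set.mem_union, Set.mem_singleton_iff, Set.mem_Ioo]
    grind
  rw [h]
  have hm : ∀ x : ℝ, MeasurableSet ({x} : Set ℝ) := measurableSet_singleton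
  exact measurable_indicator_union ((hm a).prod measurableSet_Icc)
    (hf.measurable_indicator_vertical hcd (Set.left_mem_Icc.2 hab)) <|
    measurable_indicator_union ((hm b).prod measurableSet_Icc)
    (hf.measurable_indicator_vertical hcd (Set.right_mem_Icc.2 hab)) <|
    measurable_indicator_union (measurableSet_Icc.prod (hm c))
    (horiz c (Set.left_mem_Icc.2 hcd)) <|
    measurable_indicator_union (measurableSet_Icc.prod (hm d))
    (horiz d (Set.right_mem_Icc.2 hcd)) <|
    hc.measurable_indicator (measurableSet_Ioo.prod measurableSet_Ioo)

theorem ConvexOn.exists_abs_le_rectangle {f : ℝ × ℝ → ℝ} {a b c d : ℝ}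
    (hf : ConvexOn ℝ (Set.Icc a b ×ˢ Set.Icc c d) f) :
    ∃ B, ∀ p ∈ Set.Icc a b ×ˢ Set.Icc c d, |f p| ≤ B := by
  rcases (Set.Icc a b ×ˢ Set.Icc c d).eq_empty_or_nonempty with he | ⟨p₀, hp₀⟩
  · exact ⟨0, by simp [he]⟩
  have hab : a ≤ b := hp₀.1.1.trans hp₀.1.2
  have hcd : c ≤ d := hp₀.2.1.trans hp₀.2.2
  have hsub : ({a, b} : Set ℝ) ×ˢ ({c, d} : Set ℝ) ⊆ Set.Icc a b ×ˢ Set.Icc c d :=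
    Set.prod_mono (Set.pair_subset (Set.left_mem_Icc.2 hab) (Set.right_mem_Icc.2 hab))
      (Set.pair_subset (Set.left_mem_Icc.2 hcd) (Set.right_mem_Icc.2 hcd))
  obtain ⟨M, hM⟩ := (((Set.toFinite ({a, b} : Set ℝ)).prod
    (Set.toFinite ({c, d} : Set ℝ))).image f).bddAbove
  have hupper : ∀ p ∈ Set.Icc a b ×ˢ Set.Icc c d, f p ≤ M := by
    intro p hp
    obtain ⟨q, hq, hpq⟩ := hf.exists_ge_of_mem_convexHull hsub (x := p) (by
      rwa [convexHull_prod, convexHull_pair, convexHull_pair, segment_eq_Icc hab,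
        segment_eq_Icc hcd])
    exact hpq.trans (hM ⟨q, hq, rfl⟩)
  refine ⟨max M (M - 2 * f ((a + b) / 2, (c + d) / 2)), fun p hp => ?_⟩
  have hq : (a + b - p.1, c + d - p.2) ∈ Set.Icc a b ×ˢ Set.Icc c d := by
    obtain ⟨⟨h1, h2⟩, h3, h4⟩ := hp
    refine ⟨⟨?_, ?_⟩, ?_, ?_⟩ <;> simp <;> linarith
  have hmid := hf.2 hp hq (show (0 : ℝ) ≤ 1 / 2 by norm_num)
    (show (0 : ℝ) ≤ 1 / 2 by norm_num) (by norm_num)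
  have hcenter : (1 / 2 : ℝ) • p + (1 / 2 : ℝ) • (a + b - p.1, c + d - p.2) =
      ((a + b) / 2, (c + d) / 2) := by
    ext <;> simp <;> ring
  rw [hcenter] at hmid
  simp only [smul_eq_mul] at hmid
  have h1 := hupper p hp
  have h2 := hupper _ hq
  rw [abs_le]
  have h3 := le_max_left M (M - 2 * f ((a + b) / 2, (c + d) / 2))
  have h4 := le_max_right M (M - 2 * f ((a + b) / 2, (c + d) / 2))
  constructor <;> linarith

theorem empLoss_mem_Icc {X ι : Type*} {L : ℝ → ℝ → ℝ} {F : ι → X → ℝ}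
    (hF : ∀ i x, F i x ∈ Set.Icc (-1 : ℝ) 1)
    (hL : ∀ a ∈ Set.Icc (-1 : ℝ) 1, ∀ y : ℝ, y = 1 ∨ y = -1 → L a y ∈ Set.Icc (0 : ℝ) 1)
    {m : ℕ} (hm : 0 < m) {S : Fin m → X × ℝ} (hS : ∀ k, (S k).2 = 1 ∨ (S k).2 = -1) (i : ι) :
    empLoss L F S i ∈ Set.Icc (0 : ℝ) 1 := by
  have h : ∀ k, L (F i (S k).1) (S k).2 ∈ Set.Icc (0 : ℝ) 1 := fun k => hL _ (hF _ _) _ (hS k)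
  have hm' : (0 : ℝ) < m := by exact_mod_cast hm
  refine ⟨mul_nonneg (by positivity) (Finset.sum_nonneg fun k _ => (h k).1), ?_⟩
  rw [empLoss, inv_mul_le_iff₀ hm', mul_one]
  simpa using Finset.sum_le_sum fun k (_ : k ∈ Finset.univ) => (h k).2

theorem trueLoss_mem_Icc {X ι : Type*} [MeasurableSpace X] [MeasurableSpace ι]
    {D : Measure (X × ℝ)} [IsProbabilityMeasure D] (hY : ∀ᵐ p ∂D, p.2 = 1 ∨ p.2 = -1)
    {F : ι → X → ℝ} (hF : ∀ i x, F i x ∈ Set.Icc (-1 : ℝ) 1) {L : ℝ → ℝ → ℝ}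
    (hL : ∀ a ∈ Set.Icc (-1 : ℝ) 1, ∀ y : ℝ, y = 1 ∨ y = -1 → L a y ∈ Set.Icc (0 : ℝ) 1)
    (hLmeas : Measurable fun q : ι × (X × ℝ) => L (F q.1 q.2.1) q.2.2) (i : ι) :
    trueLoss L F D i ∈ Set.Icc (0 : ℝ) 1 := by
  have h : ∀ᵐ p ∂D, L (F i p.1) p.2 ∈ Set.Icc (0 : ℝ) 1 := hY.mono fun p hp => hL _ (hF _ _) _ hp
  have hmeas : Measurable fun p : X × ℝ => L (F i p.1) p.2 := hLmeas.comp measurable_prodMk_left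
  exact (convex_Icc (0 : ℝ) 1).integral_mem isClosed_Icc h
    (Integrable.of_mem_Icc 0 1 hmeas.aemeasurable h)

theorem measurable_empLoss {X ι : Type*} [MeasurableSpace X] [MeasurableSpace ι]
    {F : ι → X → ℝ} {L : ℝ → ℝ → ℝ}
    (hLmeas : Measurable fun q : ι × (X × ℝ) => L (F q.1 q.2.1) q.2.2) (m : ℕ) :
    Measurable fun q : (Fin m → X × ℝ) × ι => empLoss L F q.1 q.2 := by
  refine (Finset.measurable_sum _ fun k _ => ?_).const_mul _
  exact hLmeas.comp (measurable_snd.prodMk ((measurable_pi_apply k).comp measurable_fst))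

theorem measurable_trueLoss {X ι : Type*} [MeasurableSpace X] [MeasurableSpace ι]
    {D : Measure (X × ℝ)} [IsProbabilityMeasure D] {F : ι → X → ℝ} {L : ℝ → ℝ → ℝ}
    (hLmeas : Measurable fun q : ι × (X × ℝ) => L (F q.1 q.2.1) q.2.2) :
    Measurable (trueLoss L F D) :=
  hLmeas.stronglyMeasurable.integral_prod_right.measurable

/-- A form of Markov's inequality: a nonnegative random variable is below its mean divided by `δ`
with probability at least `1 - δ`. -/
theorem ofReal_one_sub_le_measure_lt_integral_div {Ω : Type*} [MeasurableSpace Ω] {μ : Measure Ω}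
    [IsProbabilityMeasure μ] {Z : Ω → ℝ} (hZ : Measurable Z) (hZ0 : ∀ ω, 0 ≤ Z ω)
    (hint : Integrable Z μ) (hpos : 0 < ∫ ω, Z ω ∂μ) {δ : ℝ} (hδ : 0 < δ) :
    ENNReal.ofReal (1 - δ) ≤ μ {ω | Z ω < (1 / δ) * ∫ ω, Z ω ∂μ} := by
  set C := ∫ ω, Z ω ∂μ
  have hmarkov := mul_meas_ge_le_integral_of_nonneg (ae_of_all μ hZ0) hint ((1 / δ) * C)
  have hbad : μ.real {ω | (1 / δ) * C ≤ Z ω} ≤ δ := by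
    have h1 : C * μ.real {ω | (1 / δ) * C ≤ Z ω} ≤ C * δ := by
      calc C * μ.real {ω | (1 / δ) * C ≤ Z ω}
          = δ * ((1 / δ) * C * μ.real {ω | (1 / δ) * C ≤ Z ω}) := by field_simp
        _ ≤ δ * C := by gcongr
        _ = C * δ := mul_comm _ _
    exact le_of_mul_le_mul_left h1 hpos
  have hcompl : {ω | Z ω < (1 / δ) * C} = {ω | (1 / δ) * C ≤ Z ω}ᶜ := by
    ext ω
    simp
  rw [← ofReal_measureReal, hcompl, probReal_compl_eq_one_sub (measurableSet_le measurable_const hZ)]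
  exact ENNReal.ofReal_le_ofReal (by linarith)

/-- The PAC-Bayesian bound for a single posterior: Jensen's inequality followed by the change of
measure inequality. -/
theorem mul_convexOn_le_integral_llr_add_log {ι : Type*} [MeasurableSpace ι] {P Q : Measure ι}
    [IsProbabilityMeasure P] [IsProbabilityMeasure Q] (hQP : Q ≪ P)
    (hllr : Integrable (llr Q P) Q) {Dc : ℝ × ℝ → ℝ}
    (hDc : ConvexOn ℝ (Set.Icc (0 : ℝ) 1 ×ˢ Set.Icc (0 : ℝ) 1) Dc) {c : ℝ} (hc : 0 ≤ c)
    {u v : ι → ℝ} (hu : Measurable u) (hv : Measurable v)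
    (huv : ∀ i, (u i, v i) ∈ Set.Icc (0 : ℝ) 1 ×ˢ Set.Icc (0 : ℝ) 1) :
    c * Dc (∫ i, u i ∂Q, ∫ i, v i ∂Q) ≤
      ∫ i, llr Q P i ∂Q + Real.log (∫ i, Real.exp (c * Dc (u i, v i)) ∂P) := by
  obtain ⟨B, hB⟩ := hDc.exists_abs_le_rectangle
  have hmeas : Measurable fun i => Dc (u i, v i) := by
    have h := (hDc.measurable_indicator_rectangle zero_le_one zero_le_one).comp (hu.prodMk hv)
    convert! h using 1
    ext i
    exact (Set.indicator_of_mem (huv i) Dc).symm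
  have hint : Integrable (fun i => Dc (u i, v i)) Q :=
    .of_bound hmeas.aestronglyMeasurable B (ae_of_all _ fun i => hB _ (huv i))
  have hui : Integrable u Q :=
    Integrable.of_mem_Icc 0 1 hu.aemeasurable (ae_of_all _ fun i => (huv i).1)
  have hvi : Integrable v Q :=
    Integrable.of_mem_Icc 0 1 hv.aemeasurable (ae_of_all _ fun i => (huv i).2)
  have hexp : Integrable (fun i => Real.exp (c * Dc (u i, v i))) P := by
    refine .of_bound (hmeas.const_mul c).exp.aestronglyMeasurable (Real.exp (c * B))
      (ae_of_all _ fun i => ?_)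
    rw [Real.norm_eq_abs, Real.abs_exp]
    gcongr
    exact (le_abs_self _).trans (hB _ (huv i))
  have hjensen := hDc.map_integral_le_of_finiteDimensional (hui.prodMk hvi) (ae_of_all Q huv) hint
  rw [integral_pair hui hvi] at hjensen
  calc c * Dc (∫ i, u i ∂Q, ∫ i, v i ∂Q) ≤ c * ∫ i, Dc (u i, v i) ∂Q := by gcongr
    _ = ∫ i, c * Dc (u i, v i) ∂Q := (integral_const_mul _ _).symm
    _ ≤ _ := integral_le_integral_llr_add_log hQP hllr (hint.const_mul c) hexp

/-- General PAC-Bayesian theorem for real-valued losses: with probability at least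
`1 - δ` over `S ∼ D^m`, simultaneously for all posteriors `Q`,
`𝒟(E_{f∼Q} E_{L,S}(f), E_{f∼Q} E_{L,D}(f)) ≤
  (1/m')·[KL(Q‖P) + ln((1/δ)·E_{S'∼D^m} E_{f∼P} e^{m'·𝒟(E_{L,S'}(f), E_{L,D}(f))})]`. -/
theorem statement8 {X ι : Type*} [MeasurableSpace X] [MeasurableSpace ι]
    (D : Measure (X × ℝ)) [IsProbabilityMeasure D]
    (hY : ∀ᵐ p ∂D, p.2 = 1 ∨ p.2 = -1)
    (F : ι → X → ℝ) (hF : ∀ i x, F i x ∈ Set.Icc (-1 : ℝ) 1)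
    (L : ℝ → ℝ → ℝ)
    (hL : ∀ a ∈ Set.Icc (-1 : ℝ) 1, ∀ y : ℝ, y = 1 ∨ y = -1 → L a y ∈ Set.Icc (0 : ℝ) 1)
    (hLmeas : Measurable fun q : ι × (X × ℝ) => L (F q.1 q.2.1) q.2.2)
    (P : Measure ι) [IsProbabilityMeasure P]
    (δ : ℝ) (hδ : δ ∈ Set.Ioc (0 : ℝ) 1)
    (m' : ℝ) (hm' : 0 < m')
    (Dc : ℝ × ℝ → ℝ) (hDc : ConvexOn ℝ (Set.Icc (0 : ℝ) 1 ×ˢ Set.Icc (0 : ℝ) 1) Dc)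
    (m : ℕ) (hm : 0 < m) :
    ENNReal.ofReal (1 - δ) ≤
      (Measure.pi fun _ : Fin m => D)
        {S | ∀ Q : Measure ι, IsProbabilityMeasure Q →
          ((Dc (∫ i, empLoss L F S i ∂Q, ∫ i, trueLoss L F D i ∂Q) : ℝ) : EReal) ≤
            ((m'⁻¹ : ℝ) : EReal) *
              (klDivE Q P +
                ((Real.log ((1 / δ) *
                  ∫ S', ∫ i, Real.exp (m' * Dc (empLoss L F S' i, trueLoss L F D i)) ∂P
                    ∂(Measure.pi fun _ : Fin m => D)) : ℝ) : EReal))} := by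
  obtain ⟨B, hB⟩ := hDc.exists_abs_le_rectangle
  set R := Set.Icc (0 : ℝ) 1 ×ˢ Set.Icc (0 : ℝ) 1
  have hB0 : 0 ≤ B := (abs_nonneg _).trans (hB (0, 0) (by simp [R]))
  have hGB : ∀ p, |R.indicator Dc p| ≤ B := fun p => by
    by_cases hp : p ∈ R
    · simpa [hp] using hB p hp
    · simpa [hp] using hB0
  have hG : Measurable (R.indicator Dc) :=
    hDc.measurable_indicator_rectangle zero_le_one zero_le_one
  set μ := Measure.pi fun _ : Fin m => D
  have hlabels : ∀ᵐ S ∂μ, ∀ k, (S k).2 = 1 ∨ (S k).2 = -1 :=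
    ae_all_iff.2 fun k => (measurePreserving_eval (fun _ : Fin m => D) k).quasiMeasurePreserving.ae hY
  have hmem : ∀ S : Fin m → X × ℝ, (∀ k, (S k).2 = 1 ∨ (S k).2 = -1) → ∀ i,
      (empLoss L F S i, trueLoss L F D i) ∈ R := fun S hS i =>
    ⟨empLoss_mem_Icc hF hL hm hS i, trueLoss_mem_Icc hY hF hL hLmeas i⟩
  set W : (Fin m → X × ℝ) × ι → ℝ := fun q =>
    Real.exp (m' * R.indicator Dc (empLoss L F q.1 q.2, trueLoss L F D q.2)) with hW
  have hWmeas : Measurable W := ((hG.comp ((measurable_empLoss hLmeas m).prodMk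
    ((measurable_trueLoss hLmeas).comp measurable_snd))).const_mul m').exp
  have hWle : ∀ q, ‖W q‖ ≤ Real.exp (m' * B) := fun q => by
    rw [Real.norm_eq_abs, Real.abs_exp]
    gcongr
    exact (le_abs_self _).trans (hGB _)
  have hWint : ∀ S, Integrable (fun i => W (S, i)) P := fun S =>
    .of_bound (hWmeas.comp measurable_prodMk_left).aestronglyMeasurable _
      (ae_of_all _ fun i => hWle _)
  set Z : (Fin m → X × ℝ) → ℝ := fun S => ∫ i, W (S, i) ∂P
  have hZpos : ∀ S, 0 < Z S := fun S => integral_exp_pos (hWint S)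
  have hZmeas : Measurable Z := hWmeas.stronglyMeasurable.integral_prod_right.measurable
  have hZint : Integrable Z μ :=
    .of_bound hZmeas.aestronglyMeasurable (Real.exp (m' * B)) (ae_of_all _ fun S => by
      simpa using norm_integral_le_of_norm_le_const (μ := P) (ae_of_all _ fun i => hWle (S, i)))
  have hZeq : ∀ S : Fin m → X × ℝ, (∀ k, (S k).2 = 1 ∨ (S k).2 = -1) →
      ∫ i, Real.exp (m' * Dc (empLoss L F S i, trueLoss L F D i)) ∂P = Z S := fun S hS => by
    simp only [Z, hW, Set.indicator_of_mem (hmem S hS _)]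
  rw [integral_congr_ae (hlabels.mono hZeq)]
  have hCpos : 0 < ∫ S, Z S ∂μ := by
    rw [integral_pos_iff_support_of_nonneg (fun S => (hZpos S).le) hZint,
      Set.eq_univ_of_forall (s := Function.support Z) fun S => (hZpos S).ne']
    simp
  refine (ofReal_one_sub_le_measure_lt_integral_div hZmeas (fun S => (hZpos S).le) hZint hCpos
    hδ.1).trans (measure_mono_ae ?_)
  filter_upwards [hlabels] with S hS hSZ Q hQ
  by_cases hKL : Q ≪ P ∧ Integrable (fun i => Real.log ((Q.rnDeriv P) i).toReal) Q
  · rw [klDivE, if_pos hKL]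
    norm_cast
    rw [le_inv_mul_iff₀ hm']
    refine (mul_convexOn_le_integral_llr_add_log hKL.1 hKL.2 hDc hm'.le
      ((measurable_empLoss hLmeas m).comp measurable_prodMk_left) (measurable_trueLoss hLmeas)
      (hmem S hS)).trans (add_le_add le_rfl ?_)
    rw [Function.comp_def, hZeq S hS]
    exact Real.log_le_log (hZpos S) (le_of_lt hSZ)
  · rw [klDivE, if_neg hKL, EReal.top_add_coe, EReal.coe_mul_top_of_pos (inv_pos.2 hm')]
    exact le_top
end

section
/- For any distribution D on X × Y, any voter f : X → [-1,1], any loss L : [-1,1] × Y → [0,1], and any positive integer m: E_{S∼D^m} exp(m·kl(E_{L,S}(f) ‖ E_{L,D}(f))) ≤ ξ(m); moreover, √m ≤ ξ(m) ≤ 2√m for every positive integer m. -/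
open MeasureTheory

/-- `kl(q‖p)`: the KL divergence between Bernoulli distributions of parameters `q` and
`p` (with the conventions of Lean's `Real.log` and division, so that `0 · ln 0 = 0`). -/
noncomputable def klBin (q p : ℝ) : ℝ :=
  q * Real.log (q / p) + (1 - q) * Real.log ((1 - q) / (1 - p))

/-- `ξ(m) = Σ_{k=0}^m C(m,k)·(k/m)^k·(1 - k/m)^{m-k}` (with `0⁰ = 1`). -/
noncomputable def xi (m : ℕ) : ℝ :=
  ∑ k ∈ Finset.range (m + 1),
    (m.choose k : ℝ) * ((k : ℝ) / (m : ℝ)) ^ k * (1 - (k : ℝ) / (m : ℝ)) ^ (m - k)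

theorem sum_range_choose_mul_pow_self (N : ℕ) :
    ∑ k ∈ Finset.range (N + 1), (-1 : ℝ) ^ (N - k) * (N.choose k : ℝ) * (k : ℝ) ^ N =
      (N.factorial : ℝ) := by
  have h := congrFun (fwdDiff_iter_eq_factorial (R := ℝ) (n := N)) 0
  rw [fwdDiff_iter_eq_sum_shift] at h
  simpa [zsmul_eq_mul] using h

theorem choose_mul_pow_mul_one_sub_pow (m k : ℕ) (hk : k ≤ m) (q : ℝ) :
    (m.choose k : ℝ) * q ^ k * (1 - q) ^ (m - k) =
      ∑ N ∈ Finset.range (m + 1),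
        (m.choose N : ℝ) * ((-1) ^ (N - k) * (N.choose k : ℝ) * q ^ N) := by
  obtain ⟨d, rfl⟩ := Nat.exists_eq_add_of_le hk
  rw [add_assoc, Finset.sum_range_add, Finset.sum_eq_zero, zero_add, Nat.add_sub_cancel_left,
    sub_eq_neg_add, add_pow, Finset.mul_sum]
  · refine Finset.sum_congr rfl fun i _ => ?_
    have h := Nat.choose_mul (n := k + d) (k := k + i) (s := k) (Nat.le_add_right k i)
    simp only [Nat.add_sub_cancel_left] at h
    have h' : ((k + d).choose (k + i) : ℝ) * ((k + i).choose k : ℝ) =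
        ((k + d).choose k : ℝ) * (d.choose i : ℝ) := by exact_mod_cast h
    rw [Nat.add_sub_cancel_left, neg_pow, pow_add]
    linear_combination (-(-1) ^ i * q ^ k * q ^ i) * h'
  · intro N hN
    rw [Nat.choose_eq_zero_of_lt (Finset.mem_range.1 hN)]
    simp

/-- Cauchy's identity `ξ(m) = Σ_j m(m-1)⋯(m-j+1) / m^j`. -/
theorem xi_eq_sum_descFactorial (m : ℕ) :
    xi m = ∑ j ∈ Finset.range (m + 1), (m.descFactorial j : ℝ) / (m : ℝ) ^ j := by
  unfold xi
  rw [Finset.sum_congr rfl fun k hk => choose_mul_pow_mul_one_sub_pow m k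
    (Nat.lt_succ_iff.1 (Finset.mem_range.1 hk)) _, Finset.sum_comm]
  refine Finset.sum_congr rfl fun N hN => ?_
  have hNm : N + 1 ≤ m + 1 := Finset.mem_range.1 hN
  rw [← Finset.mul_sum, Nat.descFactorial_eq_factorial_mul_choose, Nat.cast_mul,
    ← sum_range_choose_mul_pow_self N, ← Finset.sum_subset (Finset.range_mono hNm)]
  · simp only [div_pow]
    rw [mul_comm, Finset.sum_mul, Finset.sum_mul, Finset.sum_div]
    refine Finset.sum_congr rfl fun k _ => ?_
    ring
  · intro k _ hk
    rw [Nat.choose_eq_zero_of_lt (by simpa using hk)]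
    simp

theorem mul_descFactorial_div_pow (m : ℕ) (hm : 0 < m) (j : ℕ) (hj : j ≤ m) :
    (j : ℝ) * ((m.descFactorial j : ℝ) / (m : ℝ) ^ j) =
      m * ((m.descFactorial j : ℝ) / (m : ℝ) ^ j -
        (m.descFactorial (j + 1) : ℝ) / (m : ℝ) ^ (j + 1)) := by
  have : (m : ℝ) ≠ 0 := by positivity
  rw [Nat.descFactorial_succ, Nat.cast_mul, Nat.cast_sub hj]
  field_simp
  ring

theorem sum_mul_descFactorial_div_pow (m : ℕ) (hm : 0 < m) :
    ∑ j ∈ Finset.range (m + 1), (j : ℝ) * ((m.descFactorial j : ℝ) / (m : ℝ) ^ j) = m := by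
  rw [Finset.sum_congr rfl fun j hj => mul_descFactorial_div_pow m hm j
    (Nat.lt_succ_iff.1 (Finset.mem_range.1 hj)), ← Finset.mul_sum, Finset.sum_range_sub']
  simp

theorem sum_sq_mul_descFactorial_div_pow (m : ℕ) (hm : 0 < m) :
    ∑ j ∈ Finset.range (m + 1), (j : ℝ) ^ 2 * ((m.descFactorial j : ℝ) / (m : ℝ) ^ j) =
      m * (xi m - 1) := by
  have key : ∀ (a : ℕ → ℝ) (n : ℕ), ∑ j ∈ Finset.range (n + 1), (j : ℝ) * (a j - a (j + 1)) =
      ∑ j ∈ Finset.range (n + 1), a j - a 0 - n * a (n + 1) := by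
    intro a n
    induction n with
    | zero => simp
    | succ n ih => rw [Finset.sum_range_succ, ih, Finset.sum_range_succ _ (n + 1)]; push_cast; ring
  have h := key (fun j => (m.descFactorial j : ℝ) / (m : ℝ) ^ j) m
  rw [← xi_eq_sum_descFactorial] at h
  simp only [Nat.descFactorial_of_lt (Nat.lt_succ_self m), Nat.descFactorial_zero, pow_zero,
    Nat.cast_zero, Nat.cast_one, zero_div, div_one, mul_zero, sub_zero] at h
  rw [← h, Finset.mul_sum]
  refine Finset.sum_congr rfl fun j hj => ?_
  have := mul_descFactorial_div_pow m hm j (Nat.lt_succ_iff.1 (Finset.mem_range.1 hj))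
  linear_combination (j : ℝ) * this

theorem one_le_xi (m : ℕ) : 1 ≤ xi m := by
  rw [xi_eq_sum_descFactorial, Finset.sum_range_succ']
  simp only [Nat.descFactorial_zero, pow_zero, Nat.cast_one, div_one, le_add_iff_nonneg_left]
  positivity

theorem sqrt_le_xi (m : ℕ) (hm : 0 < m) : Real.sqrt m ≤ xi m := by
  have hm' : (0 : ℝ) < m := by exact_mod_cast hm
  have h1 := one_le_xi m
  have hs := Finset.sum_nonneg (s := Finset.range (m + 1))
    (f := fun j : ℕ => (xi m - j) ^ 2 * ((m.descFactorial j : ℝ) / (m : ℝ) ^ j))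
    fun j _ => by positivity
  have he : ∑ j ∈ Finset.range (m + 1),
      (xi m - j) ^ 2 * ((m.descFactorial j : ℝ) / (m : ℝ) ^ j) =
      xi m ^ 2 * xi m - 2 * xi m * m + m * (xi m - 1) := by
    have h : ∀ x : ℝ, ∑ j ∈ Finset.range (m + 1),
        (x - j) ^ 2 * ((m.descFactorial j : ℝ) / (m : ℝ) ^ j) =
        x ^ 2 * ∑ j ∈ Finset.range (m + 1), (m.descFactorial j : ℝ) / (m : ℝ) ^ j -
          2 * x * ∑ j ∈ Finset.range (m + 1), (j : ℝ) * ((m.descFactorial j : ℝ) / (m : ℝ) ^ j) +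
          ∑ j ∈ Finset.range (m + 1), (j : ℝ) ^ 2 * ((m.descFactorial j : ℝ) / (m : ℝ) ^ j) := by
      intro x
      rw [Finset.mul_sum, Finset.mul_sum, ← Finset.sum_sub_distrib, ← Finset.sum_add_distrib]
      exact Finset.sum_congr rfl fun j _ => by ring
    rw [h, sum_sq_mul_descFactorial_div_pow m hm, sum_mul_descFactorial_div_pow m hm,
      ← xi_eq_sum_descFactorial]
  rw [Real.sqrt_le_left (by linarith)]
  rw [he] at hs
  by_contra! hlt
  nlinarith

theorem xi_le_two_mul_sqrt (m : ℕ) (hm : 0 < m) : xi m ≤ 2 * Real.sqrt m := by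
  have hs1 : 1 ≤ Real.sqrt m := by
    rw [Real.one_le_sqrt]; exact_mod_cast hm
  have hsq : Real.sqrt m ^ 2 = m := Real.sq_sqrt (Nat.cast_nonneg m)
  obtain ⟨J, hJ, hJ'⟩ : ∃ J : ℕ, Real.sqrt m ≤ J ∧ (J : ℝ) < Real.sqrt m + 1 :=
    ⟨⌈Real.sqrt m⌉₊, Nat.le_ceil _, Nat.ceil_lt_add_one (Real.sqrt_nonneg _)⟩
  set s := Real.sqrt m
  have hJm : J ≤ m + 1 := by
    have : (J : ℝ) ≤ m + 1 := by nlinarith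
    exact_mod_cast this
  have hsum : ∀ n : ℕ, ∑ j ∈ Finset.range n, ((J : ℝ) - j) = n * J - n * (n - 1) / 2 := by
    intro n
    induction n with
    | zero => simp
    | succ n ih => rw [Finset.sum_range_succ, ih]; push_cast; ring
  have hle : ∑ j ∈ Finset.range (m + 1), ((J : ℝ) - j) * ((m.descFactorial j : ℝ) / (m : ℝ) ^ j) ≤
      ∑ j ∈ Finset.range J, ((J : ℝ) - j) := by
    rw [← Finset.sum_range_add_sum_Ico _ hJm, ← add_zero (∑ j ∈ Finset.range J, ((J : ℝ) - j))]
    refine add_le_add (Finset.sum_le_sum fun j hj => ?_) (Finset.sum_nonpos fun j hj => ?_)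
    · have hj' : (j : ℝ) ≤ J := by exact_mod_cast (Finset.mem_range.1 hj).le
      refine mul_le_of_le_one_right (by linarith) (div_le_one_of_le₀ ?_ (by positivity))
      exact_mod_cast Nat.descFactorial_le_pow m j
    · have hj' : (J : ℝ) ≤ j := by exact_mod_cast (Finset.mem_Ico.1 hj).1
      exact mul_nonpos_of_nonpos_of_nonneg (by linarith) (by positivity)
  have he : ∑ j ∈ Finset.range (m + 1), ((J : ℝ) - j) * ((m.descFactorial j : ℝ) / (m : ℝ) ^ j) =
      J * xi m - m := by
    simp_rw [sub_mul]
    rw [Finset.sum_sub_distrib, ← Finset.mul_sum, sum_mul_descFactorial_div_pow m hm,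
      ← xi_eq_sum_descFactorial]
  rw [he, hsum] at hle
  have hJ0 : (0 : ℝ) < J := by linarith
  have : (J : ℝ) * xi m ≤ J * (2 * s) := by nlinarith
  exact le_of_mul_le_mul_left this hJ0

/-- A convex function of the mean of points of `[0, 1]` is at most its average under
independent Bernoulli replacements of the points. -/
theorem ConvexOn.map_mean_le_sum_bernoulli {m : ℕ} (hm : 0 < m) {φ : ℝ → ℝ}
    (hφ : ConvexOn ℝ (Set.Icc 0 1) φ) (x : Fin m → ℝ) (hx : ∀ i, x i ∈ Set.Icc (0 : ℝ) 1) :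
    φ ((m : ℝ)⁻¹ * ∑ i, x i) ≤
      ∑ s : Finset (Fin m), (∏ i, if i ∈ s then x i else 1 - x i) * φ (s.card / m) := by
  have hm' : (0 : ℝ) < m := by exact_mod_cast hm
  have expand : ∀ a b : Fin m → ℝ,
      ∏ i, (a i + b i) = ∑ s : Finset (Fin m), ∏ i, if i ∈ s then a i else b i := by
    intro a b
    rw [Fintype.prod_add]
    refine Finset.sum_congr rfl fun s _ => ?_
    rw [Finset.prod_ite]
    congr 2 <;> (ext; simp)
  have h0 : ∀ s : Finset (Fin m), 0 ≤ ∏ i, if i ∈ s then x i else 1 - x i := fun s =>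
    Finset.prod_nonneg fun i _ => by split_ifs <;> linarith [(hx i).1, (hx i).2]
  have h1 : ∑ s : Finset (Fin m), ∏ i, (if i ∈ s then x i else 1 - x i) = 1 := by
    rw [← expand]; simp
  have hcard : ∑ s : Finset (Fin m), (∏ i, if i ∈ s then x i else 1 - x i) * (s.card / m) =
      (m : ℝ)⁻¹ * ∑ i, x i := by
    have hi : ∀ i, ∑ s : Finset (Fin m),
        (if i ∈ s then ∏ j, (if j ∈ s then x j else 1 - x j) else 0) = x i := by
      intro i
      have := expand x (fun j => if j = i then 0 else 1 - x j)
      rw [Finset.prod_eq_single i (by intro j _ hj; simp [hj]) (by simp)] at this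
      simp only [if_true, add_zero] at this
      rw [this]
      refine Finset.sum_congr rfl fun s _ => ?_
      split_ifs with his
      · refine Finset.prod_congr rfl fun j _ => ?_
        split_ifs <;> simp_all
      · exact (Finset.prod_eq_zero (Finset.mem_univ i) (by simp [his])).symm
    rw [Finset.mul_sum, ← Finset.sum_congr rfl fun i _ => congrArg _ (hi i)]
    simp_rw [Finset.mul_sum]
    rw [Finset.sum_comm]
    refine Finset.sum_congr rfl fun s _ => ?_
    rw [← Finset.mul_sum, ← Finset.sum_filter, Finset.sum_const]
    simp only [Finset.filter_univ_mem, nsmul_eq_mul]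
    ring
  have := hφ.map_sum_le (t := Finset.univ) (fun s _ => h0 s) h1
    (p := fun s : Finset (Fin m) => (s.card / m : ℝ)) fun s _ => ⟨by positivity, by
      rw [div_le_one hm']; exact_mod_cast (Finset.card_le_univ s).trans_eq (Fintype.card_fin m)⟩
  simp only [smul_eq_mul] at this
  rwa [hcard] at this

theorem klBin_eq_sub_binEntropy {p : ℝ} (hp0 : 0 < p) (hp1 : p < 1) (q : ℝ) :
    klBin q p = -Real.binEntropy q + (-q * Real.log p - (1 - q) * Real.log (1 - p)) := by
  have h : ∀ a b : ℝ, b ≠ 0 → a * Real.log (a / b) = a * Real.log a - a * Real.log b := by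
    intro a b hb
    rcases eq_or_ne a 0 with rfl | ha
    · simp
    · rw [Real.log_div ha hb]; ring
  rw [klBin, h _ _ hp0.ne', h _ _ (by linarith), Real.binEntropy, Real.log_inv, Real.log_inv]
  ring

theorem convexOn_exp_mul_klBin {p : ℝ} (hp0 : 0 < p) (hp1 : p < 1) (m : ℕ) :
    ConvexOn ℝ (Set.Icc 0 1) fun q => Real.exp (m * klBin q p) := by
  have hkl : ConvexOn ℝ (Set.Icc 0 1) fun q => klBin q p := by
    simp_rw [klBin_eq_sub_binEntropy hp0 hp1]
    refine Real.strictConcave_binEntropy.concaveOn.neg.add ⟨convex_Icc 0 1, ?_⟩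
    intro x _ y _ a b _ _ hab
    simp only [smul_eq_mul]
    refine le_of_eq ?_
    linear_combination Real.log (1 - p) * hab
  refine ⟨convex_Icc 0 1, fun x hx y hy a b ha hb hab => ?_⟩
  refine le_trans ?_ (convexOn_exp.2 (Set.mem_univ _) (Set.mem_univ _) ha hb hab)
  refine Real.exp_le_exp.2 ?_
  have := mul_le_mul_of_nonneg_left (hkl.2 hx hy ha hb hab) (Nat.cast_nonneg (α := ℝ) m)
  simp only [smul_eq_mul] at this ⊢
  linarith

theorem pow_mul_exp_klBin {p : ℝ} (hp0 : 0 < p) (hp1 : p < 1) {m k : ℕ} (hm : 0 < m)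
    (hk : k ≤ m) :
    p ^ k * (1 - p) ^ (m - k) * Real.exp (m * klBin (k / m) p) =
      ((k : ℝ) / m) ^ k * (1 - (k : ℝ) / m) ^ (m - k) := by
  have hm' : (m : ℝ) ≠ 0 := by positivity
  have h : ∀ (n : ℕ) (a b : ℝ), 0 ≤ a → 0 < b → m * a = n →
      b ^ n * Real.exp (m * (a * Real.log (a / b))) = a ^ n := by
    intro n a b ha hb hn
    rw [← mul_assoc, hn]
    rcases ha.eq_or_lt with rfl | ha
    · have : n = 0 := by simpa using hn.symm
      simp [this]
    · rw [mul_comm (n : ℝ), Real.exp_mul, Real.exp_log (by positivity), Real.rpow_natCast, div_pow]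
      field_simp
  have hk' : (k : ℝ) / m ≤ 1 := by
    rw [div_le_one (by positivity)]; exact_mod_cast hk
  rw [klBin, mul_add, Real.exp_add, ← h k (k / m) p (by positivity) hp0 (by field_simp),
    ← h (m - k) (1 - k / m) (1 - p) (by linarith) (by linarith)
      (by rw [Nat.cast_sub hk]; field_simp)]
  ring

/-- Maurer's inequality for a `[0, 1]`-valued random variable. -/
theorem integral_exp_klBin_le_xi {Ω : Type*} [MeasurableSpace Ω] (D : Measure Ω)
    [IsProbabilityMeasure D] {g : Ω → ℝ} (hg : AEStronglyMeasurable g D)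
    (hg01 : ∀ᵐ ω ∂D, g ω ∈ Set.Icc (0 : ℝ) 1) {m : ℕ} (hm : 0 < m) :
    (∫ S, Real.exp (m * klBin ((m : ℝ)⁻¹ * ∑ k, g (S k)) (∫ ω, g ω ∂D))
      ∂(Measure.pi fun _ : Fin m => D)) ≤ xi m := by
  have hm' : (m : ℝ) ≠ 0 := by positivity
  have hint : Integrable g D := .of_mem_Icc 0 1 hg.aemeasurable hg01
  have hint' : Integrable (fun ω => 1 - g ω) D := (integrable_const 1).sub hint
  have hpi : ∀ {P : Ω → Prop}, (∀ᵐ ω ∂D, P ω) →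
      ∀ᵐ S ∂(Measure.pi fun _ : Fin m => D), ∀ k, P (S k) := fun h =>
    Filter.eventually_all.2 fun _ => Measure.tendsto_eval_ae_ae.eventually h
  have hconst : ∀ c p : ℝ, klBin c p = 0 → (∀ᵐ ω ∂D, g ω = c) → (∫ ω, g ω ∂D) = p →
      (∫ S, Real.exp (m * klBin ((m : ℝ)⁻¹ * ∑ k, g (S k)) (∫ ω, g ω ∂D))
        ∂(Measure.pi fun _ : Fin m => D)) ≤ xi m := by
    intro c p hc hgc hp
    rw [hp, integral_congr_ae (g := fun _ => (1 : ℝ))]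
    · simpa using one_le_xi m
    · filter_upwards [hpi hgc] with S hS
      have : (m : ℝ)⁻¹ * (m * c) = c := by field_simp
      simp [hS, this, hc]
  have hp0 : 0 ≤ ∫ ω, g ω ∂D := integral_nonneg_of_ae (hg01.mono fun _ h => h.1)
  have hq : ∫ ω, (1 - g ω) ∂D = 1 - ∫ ω, g ω ∂D := by
    rw [integral_sub (integrable_const 1) hint]; simp
  have hnn : 0 ≤ᵐ[D] fun ω => 1 - g ω := hg01.mono fun _ h => sub_nonneg.2 h.2
  have hq0 : 0 ≤ 1 - ∫ ω, g ω ∂D := hq ▸ integral_nonneg_of_ae hnn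
  rcases hp0.eq_or_lt with hp | hp
  · refine hconst 0 0 (by simp [klBin]) ?_ hp.symm
    exact (integral_eq_zero_iff_of_nonneg_ae (hg01.mono fun _ h => h.1) hint).1 hp.symm
  rcases hq0.eq_or_lt with hp' | hp'
  · refine hconst 1 1 (by simp [klBin]) ?_ (by linarith)
    filter_upwards [(integral_eq_zero_iff_of_nonneg_ae hnn hint').1 (hq.trans hp'.symm)] with ω hω
    exact (sub_eq_zero.1 hω).symm
  have hp1 : ∫ ω, g ω ∂D < 1 := by linarith
  set p := ∫ ω, g ω ∂D
  have hW : ∀ s : Finset (Fin m), Integrable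
      (fun S : Fin m → Ω => (∏ i, if i ∈ s then g (S i) else 1 - g (S i)) *
        Real.exp (m * klBin (s.card / m) p)) (Measure.pi fun _ => D) := fun s =>
    (Integrable.fintype_prod (f := fun i ω => if i ∈ s then g ω else 1 - g ω)
      fun i => by by_cases h : i ∈ s <;> simpa [h]).mul_const _
  calc
    _ ≤ ∫ S, ∑ s : Finset (Fin m), (∏ i, if i ∈ s then g (S i) else 1 - g (S i)) *
          Real.exp (m * klBin (s.card / m) p) ∂(Measure.pi fun _ : Fin m => D) :=
        integral_mono_of_nonneg (.of_forall fun _ => (Real.exp_pos _).le)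
          (integrable_finsetSum _ fun s _ => hW s) <| by
          filter_upwards [hpi hg01] with S hS
          exact (convexOn_exp_mul_klBin hp hp1 m).map_mean_le_sum_bernoulli hm _ hS
    _ = ∑ s : Finset (Fin m), p ^ s.card * (1 - p) ^ (m - s.card) *
          Real.exp (m * klBin (s.card / m) p) := by
        rw [integral_finsetSum _ fun s _ => hW s]
        refine Finset.sum_congr rfl fun s _ => ?_
        rw [integral_mul_const, integral_fintype_prod_eq_prod
          (f := fun i ω => if i ∈ s then g ω else 1 - g ω)]
        have : ∀ i, ∫ ω, (if i ∈ s then g ω else 1 - g ω) ∂D = if i ∈ s then p else 1 - p := by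
          intro i
          split_ifs
          · rfl
          · exact hq
        simp_rw [this]
        rw [Finset.prod_ite, Finset.prod_const, Finset.prod_const, Finset.filter_univ_mem,
          Finset.filter_not, Finset.filter_univ_mem, ← Finset.compl_eq_univ_sdiff,
          Finset.card_compl, Fintype.card_fin]
    _ = xi m := by
        have := Finset.sum_powerset_apply_card (x := (Finset.univ : Finset (Fin m)))
          fun k => p ^ k * (1 - p) ^ (m - k) * Real.exp (m * klBin (k / m) p)
        rw [Finset.powerset_univ, Finset.card_univ, Fintype.card_fin] at this
        rw [this, xi]
        refine Finset.sum_congr rfl fun k hk => ?_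
        rw [pow_mul_exp_klBin hp hp1 hm (Nat.lt_succ_iff.1 (Finset.mem_range.1 hk)), nsmul_eq_mul,
          mul_assoc]

/-- For any voter `f` and loss `L`,
`E_{S∼D^m} exp(m · kl(E_{L,S}(f) ‖ E_{L,D}(f))) ≤ ξ(m)`, and moreover
`√m ≤ ξ(m) ≤ 2√m` for every positive integer `m`. -/
theorem statement9 {X : Type*} [MeasurableSpace X]
    (D : Measure (X × ℝ)) [IsProbabilityMeasure D]
    (hY : ∀ᵐ p ∂D, p.2 = 1 ∨ p.2 = -1)
    (f : X → ℝ) (hf : ∀ x, f x ∈ Set.Icc (-1 : ℝ) 1)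
    (L : ℝ → ℝ → ℝ)
    (hL : ∀ a ∈ Set.Icc (-1 : ℝ) 1, ∀ y : ℝ, y = 1 ∨ y = -1 → L a y ∈ Set.Icc (0 : ℝ) 1)
    (hLmeas : Measurable fun p : X × ℝ => L (f p.1) p.2)
    (m : ℕ) (hm : 0 < m) :
    (∫ S, Real.exp ((m : ℝ) *
        klBin ((m : ℝ)⁻¹ * ∑ k, L (f (S k).1) (S k).2) (∫ p, L (f p.1) p.2 ∂D))
      ∂(Measure.pi fun _ : Fin m => D)) ≤ xi m ∧
    Real.sqrt (m : ℝ) ≤ xi m ∧ xi m ≤ 2 * Real.sqrt (m : ℝ) := by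
  refine ⟨?_, sqrt_le_xi m hm, xi_le_two_mul_sqrt m hm⟩
  exact integral_exp_klBin_le_xi D hLmeas.aestronglyMeasurable
    (hY.mono fun p hp => hL _ (hf p.1) _ hp) hm
end
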